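/- Let w be a word of length n and let i ≤ m ≤ n−1 be indices such that π_w[t+1] = π_w[t] + 1 for all i ≤ t ≤ m−1 (so {i,…,m} lies on a slope of π_w). Then for every t with i ≤ t ≤ m−1, π'_w[t] = π'_w[π_w[i] + (t − i)]. -/

import Mathlib

/- A word over alphabet `α` is modelled as `w : ℕ → α`, indexed `w 1, …, w n`. -/

/-- `IsBorder w i b`: `b` is the length of a border (possibly non-proper) of the
prefix `w[1..i]`, i.e. `b ≤ i` and `w[1..b] = w[i-b+1..i]`. -/
def IsBorder {α : Type*} (w : ℕ → α) (i b : ℕ) : Prop :=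
  b ≤ i ∧ ∀ t, 1 ≤ t → t ≤ b → w t = w (i - b + t)

/-- The failure function (border array) `π_w[i]`: the length of the longest proper
border of `w[1..i]`. -/
noncomputable def piF {α : Type*} (w : ℕ → α) (i : ℕ) : ℕ :=
  sSup {b | b < i ∧ IsBorder w i b}

/- The strong failure function `π'_w[i]` of a word of length `n`, valued in `ℤ`:
`π'_w[n] = π_w[n]`, and for `i < n` the length of the longest proper border `b` of
`w[1..i]` with `w[b+1] ≠ w[i+1]`, or `-1` if no such border exists. -/
open Classical in
noncomputable def piF' {α : Type*} (w : ℕ → α) (n i : ℕ) : ℤ :=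
  if i = n then (piF w i : ℤ)
  else if ({b | b < i ∧ IsBorder w i b ∧ w (b + 1) ≠ w (i + 1)} : Set ℕ).Nonempty
    then ((sSup {b | b < i ∧ IsBorder w i b ∧ w (b + 1) ≠ w (i + 1)} : ℕ) : ℤ)
    else -1

lemma bddAbove_properBorders {α : Type*} (w : ℕ → α) (i : ℕ) :
    BddAbove {b | b < i ∧ IsBorder w i b} :=
  ⟨i, fun _ hb => hb.1.le⟩

lemma le_piF {α : Type*} {w : ℕ → α} {i b : ℕ} (hb : b < i) (h : IsBorder w i b) :
    b ≤ piF w i :=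
  le_csSup (bddAbove_properBorders w i) ⟨hb, h⟩

lemma piF_spec {α : Type*} (w : ℕ → α) {i : ℕ} (hi : 1 ≤ i) :
    piF w i < i ∧ IsBorder w i (piF w i) :=
  Nat.sSup_mem (s := {b | b < i ∧ IsBorder w i b})
    ⟨0, hi, Nat.zero_le _, fun t h1 h2 => by omega⟩ (bddAbove_properBorders w i)

/-- Among the prefixes shorter than a border `p` of `w[1..i]`, the borders of `w[1..i]` are exactly
the borders of `w[1..p]`. -/
lemma IsBorder.iff_of_le {α : Type*} {w : ℕ → α} {i p b : ℕ} (hp : IsBorder w i p) (hb : b ≤ p) :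
    IsBorder w i b ↔ IsBorder w p b := by
  have hpi := hp.1
  have key : ∀ t, 1 ≤ t → t ≤ b → w (p - b + t) = w (i - b + t) := fun t h1 h2 => by
    rw [hp.2 (p - b + t) (by omega) (by omega)]
    congr 1
    omega
  exact ⟨fun h => ⟨hb, fun t h1 h2 => (h.2 t h1 h2).trans (key t h1 h2).symm⟩,
    fun h => ⟨hb.trans hpi, fun t h1 h2 => (h.2 t h1 h2).trans (key t h1 h2)⟩⟩

lemma apply_piF_add_one {α : Type*} {w : ℕ → α} {i : ℕ} (h : piF w (i + 1) = piF w i + 1) :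
    w (piF w i + 1) = w (i + 1) := by
  obtain ⟨hlt, hb⟩ := piF_spec w (Nat.le_add_left 1 i)
  rw [h] at hlt hb
  rw [hb.2 (piF w i + 1) (by omega) le_rfl]
  congr 1
  omega

lemma piF'_eq_piF'_piF {α : Type*} {w : ℕ → α} {n i : ℕ} (hi : 1 ≤ i) (hn : i < n)
    (h : piF w (i + 1) = piF w i + 1) : piF' w n i = piF' w n (piF w i) := by
  obtain ⟨hlt, hp⟩ := piF_spec w hi
  have hw := apply_piF_add_one h
  have hset : {b | b < i ∧ IsBorder w i b ∧ w (b + 1) ≠ w (i + 1)} =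
      {b | b < piF w i ∧ IsBorder w (piF w i) b ∧ w (b + 1) ≠ w (piF w i + 1)} := by
    ext b
    simp only [Set.mem_ofPred_eq, hw]
    constructor
    · rintro ⟨hb, hbi, hne⟩
      have hle := le_piF hb hbi
      exact ⟨lt_of_le_of_ne hle fun e => hne (e ▸ hw), (hp.iff_of_le hle).1 hbi, hne⟩
    · rintro ⟨hb, hbp, hne⟩
      exact ⟨hb.trans hlt, (hp.iff_of_le hb.le).2 hbp, hne⟩
  rw [piF', piF', if_neg hn.ne, if_neg (hlt.trans hn).ne, hset]

/-- If `{i, …, m}` lies on a slope of `π_w` (with `m ≤ n-1`), then for every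
`i ≤ t ≤ m-1`, `π'_w[t] = π'_w[π_w[i] + (t - i)]`. -/
theorem pi'_on_slope {α : Type*} (w : ℕ → α) (n i m : ℕ)
    (h0 : 1 ≤ i) (him : i ≤ m) (hm : m ≤ n - 1)
    (hslope : ∀ t, i ≤ t → t ≤ m - 1 → piF w (t + 1) = piF w t + 1) :
    ∀ t, i ≤ t → t ≤ m - 1 → piF' w n t = piF' w n (piF w i + (t - i)) := by
  intro t hit htm
  have hslope_eq : ∀ t, i ≤ t → t ≤ m - 1 → piF w t = piF w i + (t - i) := by
    intro t hit
    induction t, hit using Nat.le_induction with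
    | base => simp
    | succ t hit ih =>
      intro ht
      rw [hslope t hit (by omega), ih (by omega)]
      omega
  rw [← hslope_eq t hit htm]
  exact piF'_eq_piF'_piF (h0.trans hit) (by omega) (hslope t hit htm)
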